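/- Let n ∈ ℕ, N = {1,…,n}, and N₁ ⊊ N. Every antichain χ ∈ A_N has a unique decomposition χ = ⋁_{P ⊆ N₁} (χ_P ⊗ {P}) where each χ_P ∈ A_{N \ N₁}, and for all P, P' ⊆ N₁, P ⊆ P' implies χ_P ≥ χ_{P'}. Explicitly, the unique solution is χ_P = {X \ N₁ | X ∈ χ, P ⊆ X ∩ N₁ ... } given by χ_P = max{X \ N₁ | X ∈ χ, P ⊆ X}. -/

import Mathlib

/-!
Antichains of subsets of a finite universe
(following De Causmaecker & De Wannemacker,
"On the number of antichains of sets in a finite universe").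
-/

open scoped Classical

namespace Antichains

variable {V : Type*} [DecidableEq V]

/-- The `max` operator: keep only the non-dominated members of a family of sets. -/
def maxl (S : Finset (Finset V)) : Finset (Finset V) :=
  S.filter fun X => ∀ Y ∈ S, ¬X ⊂ Y

/-- `A` is an antichain of subsets: no two members are in a subset-superset relation. -/
def IsAC (A : Finset (Finset V)) : Prop :=
  ∀ X ∈ A, ∀ Y ∈ A, X ⊆ Y → X = Y

/-- The domination (partial) order on antichains: `acle A B` iff every member of `A`
is contained in some member of `B`. -/
def acle (A B : Finset (Finset V)) : Prop :=
  ∀ X ∈ A, ∃ Y ∈ B, X ⊆ Y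

/-- Strict domination. -/
def aclt (A B : Finset (Finset V)) : Prop :=
  acle A B ∧ ¬acle B A

/-- Join of antichains: `A ∨ B = max (A ∪ B)`. -/
def acjoin (A B : Finset (Finset V)) : Finset (Finset V) :=
  maxl (A ∪ B)

/-- Meet of antichains: `A ∧ B = max {X ∩ Y | X ∈ A, Y ∈ B}`. -/
def acmeet (A B : Finset (Finset V)) : Finset (Finset V) :=
  maxl ((A ×ˢ B).image fun p => p.1 ∩ p.2)

/-- `X⁻`: the antichain of immediate subsets of `X`. -/
def im (X : Finset V) : Finset (Finset V) :=
  X.image fun x => X.erase x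

/-- The interval poset `P_[a,b] = {X | a ∨ {X} ∈ (a,b]}`. -/
noncomputable def iposet [Fintype V] (a b : Finset (Finset V)) : Finset (Finset V) :=
  Finset.univ.filter fun X : Finset V => aclt a (acjoin a {X}) ∧ acle (acjoin a {X}) b

/-- `χ` belongs, as an antichain, to the interval `[a,b]`. -/
def memI (a b χ : Finset (Finset V)) : Prop :=
  IsAC χ ∧ acle a χ ∧ acle χ b

/-- Direct product of two antichains (with disjoint spans):
`a ⊗ b = {X ∪ Y | X ∈ a, Y ∈ b}`. -/
def dprod (a b : Finset (Finset V)) : Finset (Finset V) :=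
  (a ×ˢ b).image fun p => p.1 ∪ p.2

theorem isAC_maxl (S : Finset (Finset V)) : IsAC (maxl S) := by
  intro X hX Y hY hXY
  by_contra hne
  exact (Finset.mem_filter.1 hX).2 Y (Finset.mem_filter.1 hY).1 (hXY.ssubset_of_ne hne)

theorem mem_of_mem_maxl {S : Finset (Finset V)} {X : Finset V} (hX : X ∈ maxl S) : X ∈ S :=
  (Finset.mem_filter.1 hX).1

theorem exists_mem_maxl_superset {S : Finset (Finset V)} {X : Finset V} (hX : X ∈ S) :
    ∃ Y ∈ maxl S, X ⊆ Y := by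
  obtain ⟨Y, hXY, hY⟩ := S.exists_le_maximal hX
  exact ⟨Y, Finset.mem_filter.2 ⟨hY.1, fun Z hZ hYZ => hYZ.2 (hY.2 hZ hYZ.1)⟩, hXY⟩

theorem IsAC.subset_of_acle {W : Type*} {A B : Finset (Finset W)} (hA : IsAC A)
    (hAB : acle A B) (hBA : acle B A) : A ⊆ B := by
  intro X hX
  obtain ⟨Y, hY, hXY⟩ := hAB X hX
  obtain ⟨Z, hZ, hYZ⟩ := hBA Y hY
  have hXZ := hA X hX Z hZ (hXY.trans hYZ)
  subst hXZ
  rwa [hXY.antisymm hYZ]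

theorem IsAC.eq_of_acle {W : Type*} {A B : Finset (Finset W)} (hA : IsAC A) (hB : IsAC B)
    (hAB : acle A B) (hBA : acle B A) : A = B :=
  (hA.subset_of_acle hAB hBA).antisymm (hB.subset_of_acle hBA hAB)

theorem mem_biUnion_dprod {N₁ X : Finset V} {F : Finset V → Finset (Finset V)} :
    X ∈ (N₁.powerset.biUnion fun P => dprod (F P) {P}) ↔
      ∃ P ⊆ N₁, ∃ Y ∈ F P, Y ∪ P = X := by
  simp [dprod]

/-- The component at `P` of `χ`, namely `max {X \ N₁ | X ∈ χ, P ⊆ X}`. -/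
noncomputable def component (N₁ : Finset V) (χ : Finset (Finset V)) (P : Finset V) :
    Finset (Finset V) :=
  maxl ((χ.filter fun X => P ⊆ X).image fun X => X \ N₁)

theorem exists_of_mem_component {N₁ P Y : Finset V} {χ : Finset (Finset V)}
    (hY : Y ∈ component N₁ χ P) : ∃ X ∈ χ, P ⊆ X ∧ X \ N₁ = Y := by
  simpa [and_assoc] using mem_of_mem_maxl hY

theorem exists_mem_component_superset {N₁ P X : Finset V} {χ : Finset (Finset V)}
    (hX : X ∈ χ) (hP : P ⊆ X) : ∃ Y ∈ component N₁ χ P, X \ N₁ ⊆ Y :=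
  exists_mem_maxl_superset
    (Finset.mem_image_of_mem (· \ N₁) (Finset.mem_filter.2 ⟨hX, hP⟩))

theorem acle_component_of_subset {N₁ P P' : Finset V} (χ : Finset (Finset V)) (h : P ⊆ P') :
    acle (component N₁ χ P') (component N₁ χ P) := by
  intro Y hY
  obtain ⟨X, hX, hP', rfl⟩ := exists_of_mem_component hY
  exact exists_mem_component_superset hX (h.trans hP')

theorem eq_maxl_biUnion_of_eq_component {N₁ : Finset V} {χ : Finset (Finset V)} (hχ : IsAC χ)
    {F : Finset V → Finset (Finset V)} (hF : ∀ P ⊆ N₁, F P = component N₁ χ P) :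
    χ = maxl (N₁.powerset.biUnion fun P => dprod (F P) {P}) := by
  refine hχ.eq_of_acle (isAC_maxl _) ?_ ?_
  · intro X hX
    obtain ⟨Y, hY, hXY⟩ :=
      exists_mem_component_superset (N₁ := N₁) hX (Finset.inter_subset_left (s₂ := N₁))
    rw [← hF _ Finset.inter_subset_right] at hY
    obtain ⟨Z, hZ, hYZ⟩ := exists_mem_maxl_superset
      (mem_biUnion_dprod.2 ⟨X ∩ N₁, Finset.inter_subset_right, Y, hY, rfl⟩)
    exact ⟨Z, hZ, ((Finset.sdiff_union_inter X N₁).superset.trans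
      (Finset.union_subset_union_left hXY)).trans hYZ⟩
  · intro Z hZ
    obtain ⟨P, hP, Y, hY, rfl⟩ := mem_biUnion_dprod.1 (mem_of_mem_maxl hZ)
    rw [hF P hP] at hY
    obtain ⟨X, hX, hPX, rfl⟩ := exists_of_mem_component hY
    exact ⟨X, hX, Finset.union_subset Finset.sdiff_subset hPX⟩

theorem eq_component_of_eq_maxl_biUnion {N₁ : Finset V} {χ : Finset (Finset V)}
    {F : Finset V → Finset (Finset V)} (hAC : ∀ P ⊆ N₁, IsAC (F P))
    (hdisj : ∀ P ⊆ N₁, ∀ X ∈ F P, Disjoint X N₁)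
    (hanti : ∀ P P' : Finset V, P ⊆ N₁ → P' ⊆ N₁ → P ⊆ P' → acle (F P') (F P))
    (hχ : χ = maxl (N₁.powerset.biUnion fun P => dprod (F P) {P}))
    {P : Finset V} (hP : P ⊆ N₁) : F P = component N₁ χ P := by
  refine (hAC P hP).eq_of_acle (isAC_maxl _) ?_ ?_
  · intro Y hY
    obtain ⟨X, hX, hYX⟩ := exists_mem_maxl_superset (mem_biUnion_dprod.2 ⟨P, hP, Y, hY, rfl⟩)
    rw [← hχ] at hX
    obtain ⟨hYX, hPX⟩ := Finset.union_subset_iff.1 hYX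
    obtain ⟨Z, hZ, hXZ⟩ := exists_mem_component_superset (N₁ := N₁) hX hPX
    exact ⟨Z, hZ, (Finset.subset_sdiff.2 ⟨hYX, hdisj P hP Y hY⟩).trans hXZ⟩
  · intro Y hY
    obtain ⟨X, hX, hPX, rfl⟩ := exists_of_mem_component hY
    rw [hχ] at hX
    obtain ⟨Q, hQ, Z, hZ, rfl⟩ := mem_biUnion_dprod.1 (mem_of_mem_maxl hX)
    have hPQ : P ⊆ Q := fun x hx => (Finset.mem_union.1 (hPX hx)).resolve_left
      fun hxZ => Finset.disjoint_left.1 (hdisj Q hQ Z hZ) hxZ (hP hx)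
    obtain ⟨W, hW, hZW⟩ := hanti P Q hP hQ hPQ Z hZ
    refine ⟨W, hW, subset_trans (fun x hx => ?_) hZW⟩
    obtain ⟨hx, hxN⟩ := Finset.mem_sdiff.1 hx
    exact (Finset.mem_union.1 hx).resolve_right fun hxQ => hxN (hQ hxQ)

/-- Lemma 13 of the paper.  For `N₁ ⊊ N` (the universe), every
antichain `χ` has a unique decomposition `χ = ⋁_{P ⊆ N₁} (χ_P ⊗ {P})` into an
order-reversing tuple of antichains `χ_P` of subsets of `N₁ᶜ`; explicitly,
`χ_P = max {X \ N₁ | X ∈ χ, P ⊆ X}`. -/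
theorem statement18 {V : Type*} [DecidableEq V] [Fintype V] (N₁ : Finset V)
    (hN₁ : N₁ ⊂ Finset.univ) (χ : Finset (Finset V)) (hχ : IsAC χ) :
    (∃! F : Finset V → Finset (Finset V),
      (∀ P : Finset V, ¬P ⊆ N₁ → F P = ∅) ∧
      (∀ P : Finset V, P ⊆ N₁ → IsAC (F P) ∧ ∀ X ∈ F P, X ⊆ N₁ᶜ) ∧
      (∀ P P' : Finset V, P ⊆ N₁ → P' ⊆ N₁ → P ⊆ P' → acle (F P') (F P)) ∧
      χ = maxl (N₁.powerset.biUnion fun P => dprod (F P) {P})) ∧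
    (∀ F : Finset V → Finset (Finset V),
      ((∀ P : Finset V, ¬P ⊆ N₁ → F P = ∅) ∧
       (∀ P : Finset V, P ⊆ N₁ → IsAC (F P) ∧ ∀ X ∈ F P, X ⊆ N₁ᶜ) ∧
       (∀ P P' : Finset V, P ⊆ N₁ → P' ⊆ N₁ → P ⊆ P' → acle (F P') (F P)) ∧
       χ = maxl (N₁.powerset.biUnion fun P => dprod (F P) {P})) →
      ∀ P : Finset V, P ⊆ N₁ →
        F P = maxl ((χ.filter fun X => P ⊆ X).image fun X => X \ N₁)) := by
  have key : ∀ F : Finset V → Finset (Finset V),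
      ((∀ P : Finset V, ¬P ⊆ N₁ → F P = ∅) ∧
       (∀ P : Finset V, P ⊆ N₁ → IsAC (F P) ∧ ∀ X ∈ F P, X ⊆ N₁ᶜ) ∧
       (∀ P P' : Finset V, P ⊆ N₁ → P' ⊆ N₁ → P ⊆ P' → acle (F P') (F P)) ∧
       χ = maxl (N₁.powerset.biUnion fun P => dprod (F P) {P})) →
      ∀ P : Finset V, P ⊆ N₁ → F P = component N₁ χ P :=
    fun F ⟨_, hF, hanti, hdecomp⟩ P hP =>
      eq_component_of_eq_maxl_biUnion (fun Q hQ => (hF Q hQ).1)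
        (fun Q hQ X hX => Finset.subset_compl_iff_disjoint_right.1 ((hF Q hQ).2 X hX))
        hanti hdecomp hP
  refine ⟨⟨fun P => if P ⊆ N₁ then component N₁ χ P else ∅, ⟨?_, ?_, ?_, ?_⟩, ?_⟩, key⟩
  · exact fun P hP => if_neg hP
  · intro P hP
    simp only [if_pos hP]
    refine ⟨isAC_maxl _, fun Y hY => ?_⟩
    obtain ⟨X, -, -, rfl⟩ := exists_of_mem_component hY
    exact Finset.subset_compl_iff_disjoint_right.2 Finset.sdiff_disjoint
  · intro P P' hP hP' h
    simp only [if_pos hP, if_pos hP']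
    exact acle_component_of_subset χ h
  · exact eq_maxl_biUnion_of_eq_component hχ fun P hP => if_pos hP
  · intro F hF
    funext P
    by_cases hP : P ⊆ N₁
    · rw [if_pos hP, key F hF P hP]
    · rw [if_neg hP, hF.1 P hP]

end Antichains
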